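/- arXiv:2011.10458 — 2 statements merged into one kernel-verified Lean document; each statement's English description precedes it below -/
import Mathlib

section
/- For a complex unit hypergraph with all vertex degrees positive, the multiplicity of the eigenvalue 0 satisfies: μ₀(K) - μ₀(K*) = n - m and μ₀(L) - μ₀(L*) = n - m (as integers), and moreover μ₀(K) = μ₀(L) and μ₀(K*) = μ₀(L*), where μ₀(M) denotes the dimension of the kernel of the linear map x ↦ M x. -/
open Matrix

/-- Degree of vertex `i`: the number of edges `k` with `ω i k ≠ 0`. -/
noncomputable def deg {n m : ℕ} (ω : Fin n → Fin m → ℂ) (i : Fin n) : ℕ :=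
  Nat.card {k : Fin m // ω i k ≠ 0}

/-- Incidence matrix of a complex unit hypergraph. -/
noncomputable def incM {n m : ℕ} (ω : Fin n → Fin m → ℂ) : Matrix (Fin n) (Fin m) ℂ :=
  Matrix.of ω

/-- Degree matrix. -/
noncomputable def degM {n m : ℕ} (ω : Fin n → Fin m → ℂ) : Matrix (Fin n) (Fin n) ℂ :=
  Matrix.diagonal fun i => (deg ω i : ℂ)

/-- `μ₀ M` is the dimension of the kernel of `x ↦ M.mulVec x`. -/
noncomputable def mu0 {N : ℕ} (M : Matrix (Fin N) (Fin N) ℂ) : ℕ :=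
  Module.finrank ℂ (LinearMap.ker (Matrix.mulVecLin M))

theorem rank_add_mu0 {N : ℕ} (M : Matrix (Fin N) (Fin N) ℂ) : M.rank + mu0 M = N := by
  simpa [Matrix.rank, mu0] using LinearMap.finrank_range_add_finrank_ker M.mulVecLin

theorem rank_conjTranspose_mul_inv_diagonal_mul {n m : ℕ} (B : Matrix (Fin n) (Fin m) ℂ)
    (d : Fin n → ℕ) (hd : ∀ i, 0 < d i) :
    (Bᴴ * (Matrix.diagonal fun i => (d i : ℂ))⁻¹ * B).rank = B.rank := by
  have hsq : ∀ i, (Real.sqrt (d i) : ℂ) * Real.sqrt (d i) = d i := fun i => by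
    rw [← Complex.ofReal_mul, Real.mul_self_sqrt (Nat.cast_nonneg _), Complex.ofReal_natCast]
  have hne : ∀ i, (d i : ℂ) ≠ 0 := fun i => Nat.cast_ne_zero.mpr (hd i).ne'
  have hsne : ∀ i, (Real.sqrt (d i) : ℂ) ≠ 0 := fun i h => hne i (by rw [← hsq i, h, zero_mul])
  let S : Matrix (Fin n) (Fin n) ℂ := Matrix.diagonal fun i => (Real.sqrt (d i) : ℂ)⁻¹
  have hS : (Matrix.diagonal fun i => (d i : ℂ))⁻¹ = Sᴴ * S := by
    apply Matrix.inv_eq_right_inv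
    rw [Matrix.diagonal_conjTranspose, Matrix.diagonal_mul_diagonal,
      Matrix.diagonal_mul_diagonal, ← Matrix.diagonal_one]
    congr 1
    funext i
    simp only [Pi.star_apply, star_inv₀, Complex.star_def, Complex.conj_ofReal]
    rw [← mul_inv, hsq, mul_inv_cancel₀ (hne i)]
  have hdet : IsUnit S.det := by
    rw [Matrix.det_diagonal, isUnit_iff_ne_zero]
    exact Finset.prod_ne_zero_iff.mpr fun i _ => inv_ne_zero (hsne i)
  open scoped ComplexOrder in
  rw [hS, ← Matrix.mul_assoc, ← Matrix.conjTranspose_mul, Matrix.mul_assoc,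
    Matrix.rank_conjTranspose_mul_self, Matrix.rank_mul_eq_right_of_isUnit_det _ _ hdet]

/-- For a complex unit hypergraph with all degrees positive:
`μ₀(K) - μ₀(K*) = μ₀(L) - μ₀(L*) = n - m` (as integers), `μ₀(K) = μ₀(L)` and
`μ₀(K*) = μ₀(L*)`. -/
theorem stmt3 (n m : ℕ) (ω : Fin n → Fin m → ℂ)
    (hω : ∀ i k, ω i k = 0 ∨ ‖ω i k‖ = 1)
    (hd : ∀ i, 0 < deg ω i) :
    (mu0 (incM ω * (incM ω)ᴴ) : ℤ) - mu0 ((incM ω)ᴴ * incM ω) = (n : ℤ) - m ∧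
    (mu0 ((degM ω)⁻¹ * (incM ω * (incM ω)ᴴ)) : ℤ) -
        mu0 ((incM ω)ᴴ * (degM ω)⁻¹ * incM ω) = (n : ℤ) - m ∧
    mu0 (incM ω * (incM ω)ᴴ) = mu0 ((degM ω)⁻¹ * (incM ω * (incM ω)ᴴ)) ∧
    mu0 ((incM ω)ᴴ * incM ω) = mu0 ((incM ω)ᴴ * (degM ω)⁻¹ * incM ω) := by
  have hdet : IsUnit (degM ω)⁻¹.det := by
    rw [Matrix.isUnit_nonsing_inv_det_iff, degM, Matrix.det_diagonal, isUnit_iff_ne_zero]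
    exact Finset.prod_ne_zero_iff.mpr fun i _ => Nat.cast_ne_zero.mpr (hd i).ne'
  have hK := rank_add_mu0 (incM ω * (incM ω)ᴴ)
  have hK' := rank_add_mu0 ((incM ω)ᴴ * incM ω)
  have hL := rank_add_mu0 ((degM ω)⁻¹ * (incM ω * (incM ω)ᴴ))
  have hL' := rank_add_mu0 ((incM ω)ᴴ * (degM ω)⁻¹ * incM ω)
  open scoped ComplexOrder in
  rw [Matrix.rank_self_mul_conjTranspose] at hK
  open scoped ComplexOrder in
  rw [Matrix.rank_conjTranspose_mul_self] at hK'
  open scoped ComplexOrder in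
  rw [Matrix.rank_mul_eq_right_of_isUnit_det _ _ hdet, Matrix.rank_self_mul_conjTranspose] at hL
  rw [degM, rank_conjTranspose_mul_inv_diagonal_mul _ _ hd, ← degM] at hL'
  omega
end

section
/- Let G be a complex unit hypergraph on n vertices (all degrees positive) and let Ĝ be obtained from G by weakly deleting r vertices, i.e., restricting ω to the remaining n - r vertices. Then for M being any of the adjacency matrix A, the Kirchhoff Laplacian K, or the Hermitian normalized Laplacian 𝓛 = Id - D^{-1/2} A D^{-1/2}, the ordered eigenvalues interlace: λ_k(M(G)) ≤ λ_k(M(Ĝ)) ≤ λ_{k+r}(M(G)) for all k ∈ {1, …, n - r}. -/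
open Matrix

/-- Adjacency matrix. -/
noncomputable def adjM {n m : ℕ} (ω : Fin n → Fin m → ℂ) : Matrix (Fin n) (Fin n) ℂ :=
  Matrix.of fun i j => if i = j then 0 else -∑ k, ω i k * (starRingEnd ℂ) (ω j k)

/-- Kirchhoff Laplacian `K = D - A`. -/
noncomputable def kirLap {n m : ℕ} (ω : Fin n → Fin m → ℂ) : Matrix (Fin n) (Fin n) ℂ :=
  degM ω - adjM ω

/-- The diagonal matrix `D^{-1/2}`. -/
noncomputable def degInvSqrt {n m : ℕ} (ω : Fin n → Fin m → ℂ) :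
    Matrix (Fin n) (Fin n) ℂ :=
  Matrix.diagonal fun i => (((Real.sqrt (deg ω i))⁻¹ : ℝ) : ℂ)

/-- The Hermitian normalized Laplacian `𝓛 = Id - D^{-1/2} A D^{-1/2}`. -/
noncomputable def herLap {n m : ℕ} (ω : Fin n → Fin m → ℂ) : Matrix (Fin n) (Fin n) ℂ :=
  1 - degInvSqrt ω * adjM ω * degInvSqrt ω

/-- The eigenvalues of a Hermitian matrix, listed with multiplicity in
nondecreasing order. -/
noncomputable def sortedEigs {N : ℕ} {M : Matrix (Fin N) (Fin N) ℂ}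
    (h : M.IsHermitian) : Fin N → ℝ :=
  h.eigenvalues ∘ Tuple.sort h.eigenvalues

/-- Spectral decomposition of a Hermitian matrix with the eigenvalues in nondecreasing order. -/
theorem exists_sortedEigs_decomposition {N : ℕ} {M : Matrix (Fin N) (Fin N) ℂ}
    (h : M.IsHermitian) :
    ∃ P : Matrix (Fin N) (Fin N) ℂ, Pᴴ * P = 1 ∧
      M = Pᴴ * diagonal (fun i => (sortedEigs h i : ℂ)) * P := by
  set σ := Tuple.sort h.eigenvalues
  let U : Matrix (Fin N) (Fin N) ℂ := h.eigenvectorUnitary.1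
  have hU : U * Uᴴ = 1 := Unitary.coe_mul_star_self h.eigenvectorUnitary
  have hM : M = U * diagonal (fun i => (h.eigenvalues i : ℂ)) * Uᴴ := by
    have := h.spectral_theorem
    rw [Unitary.conjStarAlgAut_apply] at this
    exact this
  refine ⟨Uᴴ.submatrix σ id, ?_, ?_⟩
  · rw [conjTranspose_submatrix, conjTranspose_conjTranspose, submatrix_mul_equiv, hU,
      submatrix_id_id]
  · have hD : diagonal (fun i => (sortedEigs h i : ℂ)) =
        (diagonal (fun i => (h.eigenvalues i : ℂ))).submatrix σ σ := by
      rw [submatrix_diagonal_equiv]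
      rfl
    rw [hD, conjTranspose_submatrix, conjTranspose_conjTranspose, submatrix_mul_equiv,
      submatrix_mul_equiv, submatrix_id_id]
    exact hM

theorem star_dotProduct_conjTranspose_mul_mul_mulVec {ι κ : Type*} [Fintype ι] [Fintype κ]
    (P : Matrix ι κ ℂ) (D : Matrix ι ι ℂ) (x : κ → ℂ) :
    star x ⬝ᵥ (Pᴴ * D * P) *ᵥ x = star (P *ᵥ x) ⬝ᵥ D *ᵥ (P *ᵥ x) := by
  rw [star_mulVec, ← dotProduct_mulVec, mulVec_mulVec, mulVec_mulVec, Matrix.mul_assoc]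

theorem star_dotProduct_diagonal_mulVec {ι : Type*} [Fintype ι] [DecidableEq ι]
    (d : ι → ℝ) (x : ι → ℂ) :
    star x ⬝ᵥ diagonal (fun i => (d i : ℂ)) *ᵥ x = ((∑ i, d i * ‖x i‖ ^ 2 : ℝ) : ℂ) := by
  simp only [dotProduct, mulVec_diagonal, Pi.star_apply, RCLike.star_def, Complex.ofReal_sum]
  refine Finset.sum_congr rfl fun i _ => ?_
  push_cast
  rw [← Complex.conj_mul']
  ring

theorem star_dotProduct_self_eq_sum {ι : Type*} [Fintype ι] (x : ι → ℂ) :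
    star x ⬝ᵥ x = ((∑ i, ‖x i‖ ^ 2 : ℝ) : ℂ) := by
  classical
  simpa using star_dotProduct_diagonal_mulVec (fun _ => 1) x

/-- Fewer linear conditions than unknowns have a nonzero common solution. -/
theorem exists_ne_zero_mulVec_eq_zero_of_card_lt {α β κ : Type*} [Fintype α] [Fintype β]
    [Fintype κ] (A : Matrix α κ ℂ) (B : Matrix β κ ℂ)
    (h : Fintype.card α + Fintype.card β < Fintype.card κ) :
    ∃ y : κ → ℂ, y ≠ 0 ∧ A *ᵥ y = 0 ∧ B *ᵥ y = 0 := by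
  have hlt : Module.finrank ℂ ((α → ℂ) × (β → ℂ)) < Module.finrank ℂ (κ → ℂ) := by
    simpa using h
  obtain ⟨y, hy, hy0⟩ := Submodule.exists_mem_ne_zero_of_ne_bot
    (LinearMap.ker_ne_bot_of_finrank_lt (f := A.mulVecLin.prod B.mulVecLin) hlt)
  simp only [LinearMap.mem_ker, LinearMap.prod_apply, Function.prod_apply, Prod.mk_eq_zero,
    mulVecLin_apply] at hy
  exact ⟨y, hy0, hy⟩

/-- If the generalized Rayleigh quotients of two diagonal forms agree on a common space, and
fewer coordinates violate the bounds `a ≤ d` and `d' ≤ b` than the dimension of that space,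
then `a ≤ b`. -/
theorem le_of_card_add_card_lt {ι κ : Type*} [Fintype ι] [Fintype κ] [DecidableEq ι]
    [DecidableEq κ] (P : Matrix ι κ ℂ) (Q : Matrix κ κ ℂ) (hP : Pᴴ * P = 1) (hQ : Qᴴ * Q = 1)
    (d : ι → ℝ) (d' : κ → ℝ)
    (hPQ : Pᴴ * diagonal (fun i => (d i : ℂ)) * P = Qᴴ * diagonal (fun i => (d' i : ℂ)) * Q)
    (s : Finset ι) (t : Finset κ) (hst : s.card + t.card < Fintype.card κ) {a b : ℝ}
    (ha : ∀ i ∉ s, a ≤ d i) (hb : ∀ j ∉ t, d' j ≤ b) : a ≤ b := by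
  obtain ⟨y, hy, hs, ht⟩ := exists_ne_zero_mulVec_eq_zero_of_card_lt
    (P.submatrix ((↑) : s → ι) id) (Q.submatrix ((↑) : t → κ) id) (by simpa using hst)
  have hs' : ∀ i ∈ s, (P *ᵥ y) i = 0 := fun i hi => congrFun hs ⟨i, hi⟩
  have ht' : ∀ j ∈ t, (Q *ᵥ y) j = 0 := fun j hj => congrFun ht ⟨j, hj⟩
  have hform : ∑ i, d i * ‖(P *ᵥ y) i‖ ^ 2 = ∑ j, d' j * ‖(Q *ᵥ y) j‖ ^ 2 := by
    have := congrArg (fun M => star y ⬝ᵥ M *ᵥ y) hPQ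
    simp only [star_dotProduct_conjTranspose_mul_mul_mulVec,
      star_dotProduct_diagonal_mulVec] at this
    exact_mod_cast this
  have hnP : ∑ i, ‖(P *ᵥ y) i‖ ^ 2 = ∑ i, ‖y i‖ ^ 2 := by
    have := star_dotProduct_conjTranspose_mul_mul_mulVec P 1 y
    rw [Matrix.mul_one, hP, one_mulVec, one_mulVec, star_dotProduct_self_eq_sum,
      star_dotProduct_self_eq_sum] at this
    exact_mod_cast this.symm
  have hnQ : ∑ i, ‖(Q *ᵥ y) i‖ ^ 2 = ∑ i, ‖y i‖ ^ 2 := by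
    have := star_dotProduct_conjTranspose_mul_mul_mulVec Q 1 y
    rw [Matrix.mul_one, hQ, one_mulVec, one_mulVec, star_dotProduct_self_eq_sum,
      star_dotProduct_self_eq_sum] at this
    exact_mod_cast this.symm
  have hpos : 0 < ∑ i, ‖y i‖ ^ 2 := by
    obtain ⟨i, hi⟩ := Function.ne_iff.mp hy
    exact Finset.sum_pos' (fun _ _ => by positivity)
      ⟨i, Finset.mem_univ i, pow_pos (norm_pos_iff.mpr hi) 2⟩
  refine le_of_mul_le_mul_right ?_ hpos
  calc a * ∑ i, ‖y i‖ ^ 2 = ∑ i, a * ‖(P *ᵥ y) i‖ ^ 2 := by rw [← hnP, Finset.mul_sum]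
    _ ≤ ∑ i, d i * ‖(P *ᵥ y) i‖ ^ 2 := by
      refine Finset.sum_le_sum fun i _ => ?_
      by_cases hi : i ∈ s
      · simp [hs' i hi]
      · exact mul_le_mul_of_nonneg_right (ha i hi) (by positivity)
    _ = ∑ j, d' j * ‖(Q *ᵥ y) j‖ ^ 2 := hform
    _ ≤ ∑ j, b * ‖(Q *ᵥ y) j‖ ^ 2 := by
      refine Finset.sum_le_sum fun j _ => ?_
      by_cases hj : j ∈ t
      · simp [ht' j hj]
      · exact mul_le_mul_of_nonneg_right (hb j hj) (by positivity)
    _ = b * ∑ i, ‖y i‖ ^ 2 := by rw [← hnQ, Finset.mul_sum]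

theorem sortedEigs_monotone {N : ℕ} {M : Matrix (Fin N) (Fin N) ℂ} (h : M.IsHermitian) :
    Monotone (sortedEigs h) :=
  Tuple.monotone_sort h.eigenvalues

/-- **Poincaré separation theorem**, lower bound, for the compression of `M` by an isometry. -/
theorem sortedEigs_le_sortedEigs_compression {n p : ℕ} {M : Matrix (Fin n) (Fin n) ℂ}
    {S : Matrix (Fin p) (Fin p) ℂ} (hM : M.IsHermitian) (hS : S.IsHermitian)
    (E : Matrix (Fin n) (Fin p) ℂ) (hE : Eᴴ * E = 1) (hSE : S = Eᴴ * M * E)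
    (i : Fin n) (j : Fin p) (hij : (i : ℕ) ≤ j) : sortedEigs hM i ≤ sortedEigs hS j := by
  obtain ⟨P, hP, hMP⟩ := exists_sortedEigs_decomposition hM
  obtain ⟨Q, hQ, hSQ⟩ := exists_sortedEigs_decomposition hS
  refine le_of_card_add_card_lt (P * E) Q ?_ hQ (sortedEigs hM) (sortedEigs hS) ?_
    (Finset.Iio i) (Finset.Ioi j) ?_ ?_ ?_
  · rw [conjTranspose_mul, Matrix.mul_assoc, ← Matrix.mul_assoc Pᴴ, hP, Matrix.one_mul, hE]
  · rw [← hSQ, hSE, conjTranspose_mul]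
    conv_rhs => rw [hMP]
    simp only [Matrix.mul_assoc]
  · rw [Fin.card_Iio, Fin.card_Ioi, Fintype.card_fin]
    omega
  · exact fun l hl => sortedEigs_monotone hM (by simpa using hl)
  · exact fun l hl => sortedEigs_monotone hS (by simpa using hl)

theorem sortedEigs_compression_le_sortedEigs {n p : ℕ} {M : Matrix (Fin n) (Fin n) ℂ}
    {S : Matrix (Fin p) (Fin p) ℂ} (hM : M.IsHermitian) (hS : S.IsHermitian)
    (E : Matrix (Fin n) (Fin p) ℂ) (hE : Eᴴ * E = 1) (hSE : S = Eᴴ * M * E)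
    (i : Fin n) (j : Fin p) (hij : n + j ≤ p + i) : sortedEigs hS j ≤ sortedEigs hM i := by
  obtain ⟨P, hP, hMP⟩ := exists_sortedEigs_decomposition hM
  obtain ⟨Q, hQ, hSQ⟩ := exists_sortedEigs_decomposition hS
  refine neg_le_neg_iff.mp <| le_of_card_add_card_lt (P * E) Q ?_ hQ (fun l => -sortedEigs hM l)
    (fun l => -sortedEigs hS l) ?_ (Finset.Ioi i) (Finset.Iio j) ?_ ?_ ?_
  · rw [conjTranspose_mul, Matrix.mul_assoc, ← Matrix.mul_assoc Pᴴ, hP, Matrix.one_mul, hE]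
  · simp only [Complex.ofReal_neg, ← diagonal_neg, Matrix.mul_neg, Matrix.neg_mul]
    rw [← hSQ, hSE, conjTranspose_mul]
    conv_rhs => rw [hMP]
    simp only [Matrix.mul_assoc]
  · rw [Fin.card_Iio, Fin.card_Ioi, Fintype.card_fin]
    omega
  · exact fun l hl => neg_le_neg (sortedEigs_monotone hM (by simpa using hl))
  · exact fun l hl => neg_le_neg (sortedEigs_monotone hS (by simpa using hl))

/-- **Cauchy interlacing theorem** for principal submatrices. -/
theorem sortedEigs_submatrix_interlace {n r : ℕ} {M : Matrix (Fin n) (Fin n) ℂ}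
    {S : Matrix (Fin (n - r)) (Fin (n - r)) ℂ} (hM : M.IsHermitian) (hS : S.IsHermitian)
    (f : Fin (n - r) → Fin n) (hf : Function.Injective f) (hSf : S = M.submatrix f f)
    (k : ℕ) (hk : k < n - r) :
    sortedEigs hM ⟨k, by omega⟩ ≤ sortedEigs hS ⟨k, hk⟩ ∧
      sortedEigs hS ⟨k, hk⟩ ≤ sortedEigs hM ⟨k + r, by omega⟩ := by
  set E : Matrix (Fin n) (Fin (n - r)) ℂ := (1 : Matrix (Fin n) (Fin n) ℂ).submatrix id f
  have hE : Eᴴ * E = 1 := by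
    rw [conjTranspose_submatrix, conjTranspose_one,
      ← submatrix_mul _ _ f id f Function.bijective_id, Matrix.one_mul, submatrix_one f hf]
  have hSE : S = Eᴴ * M * E := by
    rw [hSf, conjTranspose_submatrix, conjTranspose_one, ← submatrix_id_id M,
      ← submatrix_mul _ _ f id id Function.bijective_id,
      ← submatrix_mul _ _ f id f Function.bijective_id, Matrix.one_mul, Matrix.mul_one,
      submatrix_id_id]
  exact ⟨sortedEigs_le_sortedEigs_compression hM hS E hE hSE _ _ le_rfl,
    sortedEigs_compression_le_sortedEigs hM hS E hE hSE _ _ (by dsimp only; omega)⟩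

section WeakDeletion

variable {n p m : ℕ} (ω : Fin n → Fin m → ℂ) {f : Fin p → Fin n}

theorem adjM_comp (hf : Function.Injective f) :
    adjM (fun i k => ω (f i) k) = (adjM ω).submatrix f f := by
  ext i j
  simp [adjM, hf.eq_iff]

theorem kirLap_comp (hf : Function.Injective f) :
    kirLap (fun i k => ω (f i) k) = (kirLap ω).submatrix f f := by
  rw [kirLap, kirLap, adjM_comp ω hf, submatrix_sub, degM, degM, Pi.sub_apply, Pi.sub_apply,
    submatrix_diagonal _ f hf]
  rfl

theorem herLap_comp (hf : Function.Injective f) :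
    herLap (fun i k => ω (f i) k) = (herLap ω).submatrix f f := by
  rw [herLap, adjM_comp ω hf]
  ext i j
  simp [herLap, degInvSqrt, deg, one_apply, hf.eq_iff]

end WeakDeletion

/-- Cauchy interlacing under weak deletion of `r` vertices, for the adjacency matrix,
the Kirchhoff Laplacian and the Hermitian normalized Laplacian. -/
theorem stmt7 (n m r : ℕ) (hr : r ≤ n) (ω : Fin n → Fin m → ℂ)
    (hω : ∀ i k, ω i k = 0 ∨ ‖ω i k‖ = 1)
    (hd : ∀ i, 0 < deg ω i)
    (f : Fin (n - r) → Fin n) (hf : Function.Injective f)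
    (hA : (adjM ω).IsHermitian)
    (hA' : (adjM (fun i k => ω (f i) k)).IsHermitian)
    (hK : (kirLap ω).IsHermitian)
    (hK' : (kirLap (fun i k => ω (f i) k)).IsHermitian)
    (hL : (herLap ω).IsHermitian)
    (hL' : (herLap (fun i k => ω (f i) k)).IsHermitian) :
    ∀ (k : ℕ) (hk : k < n - r),
      (sortedEigs hA ⟨k, by omega⟩ ≤ sortedEigs hA' ⟨k, hk⟩ ∧
        sortedEigs hA' ⟨k, hk⟩ ≤ sortedEigs hA ⟨k + r, by omega⟩) ∧
      (sortedEigs hK ⟨k, by omega⟩ ≤ sortedEigs hK' ⟨k, hk⟩ ∧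
        sortedEigs hK' ⟨k, hk⟩ ≤ sortedEigs hK ⟨k + r, by omega⟩) ∧
      (sortedEigs hL ⟨k, by omega⟩ ≤ sortedEigs hL' ⟨k, hk⟩ ∧
        sortedEigs hL' ⟨k, hk⟩ ≤ sortedEigs hL ⟨k + r, by omega⟩) := by
  exact fun k hk =>
    ⟨sortedEigs_submatrix_interlace hA hA' f hf (adjM_comp ω hf) k hk,
      sortedEigs_submatrix_interlace hK hK' f hf (kirLap_comp ω hf) k hk,
      sortedEigs_submatrix_interlace hL hL' f hf (herLap_comp ω hf) k hk⟩
end
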